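/- With the notation of the context, for every index vector w ∈ ℤ^m one has s^{−k*}·(Σ_{j=1}^{m−1} s^{2j})·det M[λ*, l]_w + s^{k*}·det M[ρ*, r]_w = s^{−k*}·Σ_{j=1}^{m} det M_j, where M_j is the m×m matrix whose (i,j)-entry in its distinguished column j is s^{2j}·ρ*_{w_i − j + 1} for i ≤ k* and s^{2j−2}·r_{w_i + j − 1} for i > k*, and whose (i,j')-entry in every other column j' ≠ j is λ*_{w_i − j' + 1} for i ≤ k* and l_{w_i + j' − 1} for i > k*. -/

import Mathlib

/-- Expansion of a determinant whose columns are two-term combinations of consecutive columns of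
`U` into the maximal minors of `U`. -/
theorem det_succ_sub_mul_castSucc {A : Type*} [CommRing A] {m : ℕ}
    (U : Matrix (Fin m) (Fin (m + 1)) A) (c : ℕ → A) :
    (Matrix.of fun i j : Fin m => U i j.succ - c j * U i j.castSucc).det =
      ∑ i : Fin (m + 1), (-1) ^ (i : ℕ) * (∏ j ∈ Finset.range i, c j) *
        (U.submatrix id i.succAbove).det := by
  let N : Matrix (Fin (m + 1)) (Fin (m + 1)) A :=
    Matrix.of fun i j => Fin.cases (∏ p ∈ Finset.range j, c p) (fun i' => U i' j) i
  let B : Matrix (Fin (m + 1)) (Fin (m + 1)) A :=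
    Matrix.of fun i j => Fin.cases (N i 0) (fun j' => N i j'.succ - c j' * N i j'.castSucc) j
  have hNB : N.det = B.det :=
    Matrix.det_eq_of_forall_col_eq_smul_add_pred (fun j : Fin m => c j)
      (fun i => by simp [B]) (fun i j => by simp [B])
  have hN : N.det = ∑ i : Fin (m + 1), (-1) ^ (i : ℕ) * (∏ j ∈ Finset.range i, c j) *
      (U.submatrix id i.succAbove).det := by
    rw [Matrix.det_succ_row_zero]
    rfl
  have hB : B.det = (Matrix.of fun i j : Fin m => U i j.succ - c j * U i j.castSucc).det := by
    rw [Matrix.det_succ_row_zero, Fin.sum_univ_succ, Finset.sum_eq_zero]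
    · have h00 : B 0 0 = 1 := by simp [B, N]
      rw [h00]
      simp only [Fin.val_zero, pow_zero, one_mul, add_zero]
      rfl
    · intro j _
      have h0 : B 0 j.succ = 0 := by
        simp [B, N, Finset.prod_range_succ, mul_comm]
      rw [h0]
      ring
  rw [← hB, ← hNB, hN]

theorem sum_range_pow_mul_ite_lt {A : Type*} [CommRing A] (t : A) (i m : ℕ) :
    ∑ p ∈ Finset.range m, t ^ p * (if p < i then t else 1) =
      ∑ p ∈ Finset.range m, t ^ p + t ^ min i m - 1 := by
  induction m with
  | zero => simp
  | succ m ih =>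
    rw [Finset.sum_range_succ, Finset.sum_range_succ, ih]
    split_ifs with h
    · rw [min_eq_right h.le, min_eq_right (Nat.succ_le_of_lt h), pow_succ]
      ring
    · rw [min_eq_left (not_lt.mp h), min_eq_left (by omega)]
      ring

theorem prod_range_ite_eq_mul {A : Type*} [CommRing A] (t b : A) (p i : ℕ) :
    ∏ j ∈ Finset.range i, (if j = p then t * b else b) = (if p < i then t else 1) * b ^ i := by
  have h : ∀ j, (if j = p then t * b else b) = (if j = p then t else 1) * b := by
    intro j; split_ifs <;> simp
  rw [Finset.prod_congr rfl fun j _ => h j, Finset.prod_mul_distrib]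
  simp [Finset.prod_ite_eq']

theorem sum_pow_mul_det_replace_column {A : Type*} [CommRing A] {m : ℕ}
    (U : Matrix (Fin m) (Fin (m + 1)) A) (t b : A) :
    ∑ p ∈ Finset.range m, t ^ p * (Matrix.of fun i j : Fin m =>
        U i j.succ - (if (j : ℕ) = p then t * b else b) * U i j.castSucc).det =
      (∑ p ∈ Finset.range m, t ^ p - 1) *
          (Matrix.of fun i j : Fin m => U i j.succ - b * U i j.castSucc).det +
        (Matrix.of fun i j : Fin m => U i j.succ - t * b * U i j.castSucc).det := by
  rw [det_succ_sub_mul_castSucc U fun _ => b, det_succ_sub_mul_castSucc U fun _ => t * b]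
  simp_rw [fun p : ℕ => det_succ_sub_mul_castSucc U fun j => if j = p then t * b else b,
    prod_range_ite_eq_mul, Finset.prod_const, Finset.card_range, Finset.mul_sum]
  rw [Finset.sum_comm, ← Finset.sum_add_distrib]
  refine Finset.sum_congr rfl fun i _ => ?_
  have h := sum_range_pow_mul_ite_lt t i m
  rw [min_eq_left (Nat.le_of_lt_succ i.2)] at h
  calc _ = (∑ p ∈ Finset.range m, t ^ p * (if p < (i : ℕ) then t else 1)) *
        ((-1) ^ (i : ℕ) * b ^ (i : ℕ) * (U.submatrix id i.succAbove).det) := by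
          rw [Finset.sum_mul]
          exact Finset.sum_congr rfl fun p _ => by ring
    _ = _ := by rw [h]; ring

theorem stmt7 {A : Type*} [CommRing A] (s a : Aˣ)
    (y ystar l r lamstar rhostar : ℤ → A)
    (hyl : ∀ n : ℤ, y n = (↑s⁻¹ : A) * (↑a : A) * y (n - 1) + l n)
    (hyr : ∀ n : ℤ, y n = (↑s : A) * (↑a : A) * y (n - 1) + r n)
    (hyL : ∀ n : ℤ, ystar (n - 1) = (↑s⁻¹ : A) * (↑a : A) * (ystar n - lamstar n))
    (hyR : ∀ n : ℤ, ystar (n - 1) = (↑s : A) * (↑a : A) * (ystar n - rhostar n))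
    (kstar k : ℕ) (hm : 1 ≤ kstar + k) (w : Fin (kstar + k) → ℤ) :
    (↑s⁻¹ : A) ^ kstar * (∑ j ∈ Finset.Icc 1 (kstar + k - 1), (↑s : A) ^ (2 * j)) *
          (Matrix.of fun i j : Fin (kstar + k) =>
            if (i : ℕ) < kstar then lamstar (w i - ((j : ℕ) : ℤ))
            else l (w i + ((j : ℕ) : ℤ))).det +
        (↑s : A) ^ kstar *
          (Matrix.of fun i j : Fin (kstar + k) =>
            if (i : ℕ) < kstar then rhostar (w i - ((j : ℕ) : ℤ))
            else r (w i + ((j : ℕ) : ℤ))).det =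
      (↑s⁻¹ : A) ^ kstar * ∑ j ∈ Finset.Icc 1 (kstar + k),
        (Matrix.of fun i j' : Fin (kstar + k) =>
          if (j' : ℕ) = j - 1 then
            (if (i : ℕ) < kstar then (↑s : A) ^ (2 * j) * rhostar (w i - ((j' : ℕ) : ℤ))
             else (↑s : A) ^ (2 * j - 2) * r (w i + ((j' : ℕ) : ℤ)))
          else
            (if (i : ℕ) < kstar then lamstar (w i - ((j' : ℕ) : ℤ))
             else l (w i + ((j' : ℕ) : ℤ)))).det := by
  let U : Matrix (Fin (kstar + k)) (Fin (kstar + k + 1)) A := Matrix.of fun i j =>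
    if (i : ℕ) < kstar then -((s : A) * (↑a⁻¹ : A) * ystar (w i - ((j : ℕ) : ℤ)))
    else y (w i + ((j : ℕ) : ℤ) - 1)
  obtain ⟨b, hb⟩ : ∃ b : A, b = (↑s⁻¹ : A) * (↑a : A) := ⟨_, rfl⟩
  have hs : (s : A) * (↑s⁻¹ : A) = 1 := s.mul_inv
  have ha : (a : A) * (↑a⁻¹ : A) = 1 := a.mul_inv
  have hL : ∀ i j : Fin (kstar + k), (if (i : ℕ) < kstar then lamstar (w i - ((j : ℕ) : ℤ))
      else l (w i + ((j : ℕ) : ℤ))) = U i j.succ - b * U i j.castSucc := by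
    intro i j
    simp only [U, Matrix.of_apply, Fin.val_succ, Fin.val_castSucc, Nat.cast_add, Nat.cast_one]
    split_ifs
    · have h := hyL (w i - ((j : ℕ) : ℤ))
      rw [sub_sub] at h
      rw [h, hb]
      linear_combination (-lamstar (w i - ((j : ℕ) : ℤ)) * (a * ↑a⁻¹)) * hs -
        lamstar (w i - ((j : ℕ) : ℤ)) * ha
    · have h := hyl (w i + ((j : ℕ) : ℤ))
      rw [← add_assoc, add_sub_cancel_right, hb]
      linear_combination -h
  have hR : ∀ i j : Fin (kstar + k), (if (i : ℕ) < kstar then (s : A) ^ 2 * rhostar (w i - ((j : ℕ) : ℤ))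
      else r (w i + ((j : ℕ) : ℤ))) = U i j.succ - (s : A) ^ 2 * b * U i j.castSucc := by
    intro i j
    simp only [U, Matrix.of_apply, Fin.val_succ, Fin.val_castSucc, Nat.cast_add, Nat.cast_one]
    split_ifs
    · have h := hyR (w i - ((j : ℕ) : ℤ))
      rw [sub_sub] at h
      rw [h, hb]
      linear_combination (-(s : A) ^ 2 * ystar (w i - ((j : ℕ) : ℤ)) * (a * ↑a⁻¹)) * hs -
        (s : A) ^ 2 * rhostar (w i - ((j : ℕ) : ℤ)) * ha
    · have h := hyr (w i + ((j : ℕ) : ℤ))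
      rw [← add_assoc, add_sub_cancel_right, hb]
      linear_combination -h + s * a * y (w i + ((j : ℕ) : ℤ) - 1) * hs
  have hRdet : (Matrix.of fun i j : Fin (kstar + k) =>
        U i j.succ - (s : A) ^ 2 * b * U i j.castSucc).det =
      (s : A) ^ (2 * kstar) * (Matrix.of fun i j : Fin (kstar + k) =>
        if (i : ℕ) < kstar then rhostar (w i - ((j : ℕ) : ℤ))
        else r (w i + ((j : ℕ) : ℤ))).det := by
    have hprod : ∏ i : Fin (kstar + k), (if (i : ℕ) < kstar then (s : A) ^ 2 else 1) =
        (s : A) ^ (2 * kstar) := by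
      rw [Fin.prod_univ_add]
      simp [pow_mul]
    rw [← hprod, ← Matrix.det_mul_column]
    congr 1
    ext i j
    simp only [Matrix.of_apply, ← hR]
    split_ifs <;> simp
  have hcol : ∀ p ∈ Finset.range (kstar + k), (Matrix.of fun i j' : Fin (kstar + k) =>
          if (j' : ℕ) = 1 + p - 1 then
            (if (i : ℕ) < kstar then
              (s : A) ^ (2 * (1 + p)) * rhostar (w i - ((j' : ℕ) : ℤ))
             else (s : A) ^ (2 * (1 + p) - 2) * r (w i + ((j' : ℕ) : ℤ)))
          else
            (if (i : ℕ) < kstar then lamstar (w i - ((j' : ℕ) : ℤ))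
             else l (w i + ((j' : ℕ) : ℤ)))).det =
      ((s : A) ^ 2) ^ p * (Matrix.of fun i j : Fin (kstar + k) =>
        U i j.succ - (if (j : ℕ) = p then (s : A) ^ 2 * b else b) * U i j.castSucc).det := by
    intro p hp
    have hprod : ∏ j : Fin (kstar + k), (if j = ⟨p, Finset.mem_range.mp hp⟩ then ((s : A) ^ 2) ^ p else 1) =
        ((s : A) ^ 2) ^ p := by simp
    rw [← hprod, ← Matrix.det_mul_row]
    congr 1
    ext i j
    have e1 : 1 + p - 1 = p := by omega
    have e2 : 2 * (1 + p) - 2 = 2 * p := by omega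
    simp only [Matrix.of_apply, e1, e2, Fin.ext_iff]
    by_cases hj : (j : ℕ) = p
    · simp only [hj, if_true]
      rw [← hj, ← hR]
      split_ifs <;> ring
    · simp only [hj, if_false]
      rw [hL, one_mul]
  have hIcc : ∀ n : ℕ, Finset.Icc 1 n = Finset.Ico 1 (n + 1) := fun n => by
    ext; simp
  have hgeom : ∑ j ∈ Finset.Icc 1 (kstar + k - 1), (s : A) ^ (2 * j) =
      ∑ p ∈ Finset.range (kstar + k), ((s : A) ^ 2) ^ p - 1 := by
    rw [hIcc, Nat.sub_add_cancel hm, Finset.range_eq_Ico, Finset.sum_eq_sum_Ico_succ_bot hm]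
    simp [pow_mul]
  rw [hgeom, hIcc, Finset.sum_Ico_eq_sum_range, Nat.add_sub_cancel, Finset.sum_congr rfl hcol,
    sum_pow_mul_det_replace_column, hRdet]
  simp only [hL]
  have hsk : (↑s⁻¹ : A) ^ kstar * (s : A) ^ (2 * kstar) = (s : A) ^ kstar := by
    rw [two_mul, pow_add, ← mul_assoc, ← mul_pow, s.inv_mul, one_pow, one_mul]
  rw [mul_add, ← mul_assoc, ← mul_assoc, hsk]
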